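/- arXiv:0811.0208 — 2 statements merged into one kernel-verified Lean document; each statement's English description precedes it below -/
import Mathlib

section
/- Let X be a compact length space, Y ⊆ X a nonempty closed subset, F : Y → ℝ Lipschitz, ε > 0 and θ ∈ (−1,1), and let u^ε be the unique bounded function on X extending F that is (θ,ε)-infinity harmonic on X∖Y. If v : X → ℝ is bounded from below, is (θ,ε)-infinity harmonic on X∖Y, and satisfies v ≥ F on Y, then v ≥ u^ε on all of X. Symmetrically, if v : X → ℝ is bounded from above, is (θ,ε)-infinity harmonic on X∖Y, and satisfies v ≤ F on Y, then v ≤ u^ε on all of X. -/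
open Set Metric Filter

noncomputable section

/-- A metric space is a **length space** if the distance between any two points equals the
infimum of the lengths of continuous paths joining them. -/
def IsLengthSpace (X : Type*) [MetricSpace X] : Prop :=
  ∀ x y : X, edist x y = ⨅ γ : Path x y, eVariationOn (fun t => γ t) Set.univ

/-- `u` is `(θ, ε)`-infinity harmonic on `S`: for every `x ∈ S` the supremum and infimum of `u`
over the open ball `B_ε(x)` are finite and
`u(x) = ((1+θ)/2)·sup_{B_ε(x)} u + ((1−θ)/2)·inf_{B_ε(x)} u`. -/
def InfinityHarmonicOn {X : Type*} [MetricSpace X] (θ ε : ℝ) (S : Set X) (u : X → ℝ) : Prop :=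
  ∀ x ∈ S, BddAbove (u '' ball x ε) ∧ BddBelow (u '' ball x ε) ∧
    u x = ((1 + θ) / 2) * sSup (u '' ball x ε) + ((1 - θ) / 2) * sInf (u '' ball x ε)

/-- `φ` is a **β-exponential cone** centered at `x₀`:
`φ(x) = sgn(β)·A·(1 − e^{−β d(x₀,x)}) + B` (positive cone) or
`φ(x) = sgn(β)·A·(1 − e^{β d(x₀,x)}) + B` (negative cone), with `A ≥ 0`, `B ∈ ℝ`. -/
def IsExpCone {X : Type*} [MetricSpace X] (β : ℝ) (x₀ : X) (φ : X → ℝ) : Prop :=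
  ∃ A B : ℝ, 0 ≤ A ∧
    ((∀ x, φ x = Real.sign β * A * (1 - Real.exp (-β * dist x₀ x)) + B) ∨
     (∀ x, φ x = Real.sign β * A * (1 - Real.exp (β * dist x₀ x)) + B))

/-- Comparison with β-exponential cones **from above** on `X ∖ Y`. -/
def CECA {X : Type*} [MetricSpace X] (β : ℝ) (Y : Set X) (u : X → ℝ) : Prop :=
  ∀ V : Set X, IsOpen V → V ⊆ Yᶜ → (∃ r > 0, ∀ v ∈ V, ∀ y ∈ Y, r ≤ dist v y) →
    ∀ x₀ : X, ∀ φ : X → ℝ, IsExpCone β x₀ φ →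
      (∀ x ∈ frontier (V \ {x₀}), u x ≤ φ x) → ∀ x ∈ V, u x ≤ φ x

/-- Comparison with β-exponential cones **from below** on `X ∖ Y`. -/
def CECB {X : Type*} [MetricSpace X] (β : ℝ) (Y : Set X) (u : X → ℝ) : Prop :=
  ∀ V : Set X, IsOpen V → V ⊆ Yᶜ → (∃ r > 0, ∀ v ∈ V, ∀ y ∈ Y, r ≤ dist v y) →
    ∀ x₀ : X, ∀ φ : X → ℝ, IsExpCone β x₀ φ →
      (∀ x ∈ frontier (V \ {x₀}), φ x ≤ u x) → ∀ x ∈ V, φ x ≤ u x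

/-- Comparison with β-exponential cones on `X ∖ Y`. -/
def CEC {X : Type*} [MetricSpace X] (β : ℝ) (Y : Set X) (u : X → ℝ) : Prop :=
  CECA β Y u ∧ CECB β Y u

open Classical in
/-- The modified metric `d^ε`: `d^ε(x,y) = ε + ε⌊d(x,y)/ε⌋` for `x ≠ y`, `d^ε(x,x) = 0`. -/
noncomputable def dEps {X : Type*} [MetricSpace X] (ε : ℝ) (x y : X) : ℝ :=
  if x = y then 0 else ε + ε * (⌊dist x y / ε⌋ : ℝ)

/-- `d^ε(X) = sup_{x₁,x₂ ∈ X} d^ε(x₁,x₂)`. -/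
noncomputable def dEpsDiam (X : Type*) [MetricSpace X] (ε : ℝ) : ℝ :=
  ⨆ p : X × X, dEps ε p.1 p.2

/-- `ρ` satisfies condition (⋆) for `β`: `ρ` is a smooth positive function on a neighbourhood of
`0` with `ρ(0) = 1`, `ρ′(0) = β`, whose logarithm is concave or convex. -/
def OddsCondition (β : ℝ) (ρ : ℝ → ℝ) : Prop :=
  ∃ a : ℝ, 0 < a ∧ ContDiffOn ℝ (⊤ : ℕ∞) ρ (Ioo (-a) a) ∧ (∀ x ∈ Ioo (-a) a, 0 < ρ x) ∧
    ρ 0 = 1 ∧ deriv ρ 0 = β ∧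
    (ConvexOn ℝ (Ioo (-a) a) (fun x => Real.log (ρ x)) ∨
     ConcaveOn ℝ (Ioo (-a) a) (fun x => Real.log (ρ x)))

end

/-- `u` is bounded above on `S` by the weighted average, with weights `p` and `q`, of its supremum
and infimum over `ε`-balls. -/
def SubAverageOn {X : Type*} [MetricSpace X] (p q ε : ℝ) (S : Set X) (u : X → ℝ) : Prop :=
  ∀ x ∈ S, u x ≤ p * sSup (u '' ball x ε) + q * sInf (u '' ball x ε)

/-- `u` is bounded below on `S` by the weighted average, with weights `p` and `q`, of its supremum
and infimum over `ε`-balls. -/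
def SuperAverageOn {X : Type*} [MetricSpace X] (p q ε : ℝ) (S : Set X) (u : X → ℝ) : Prop :=
  ∀ x ∈ S, p * sSup (u '' ball x ε) + q * sInf (u '' ball x ε) ≤ u x

theorem sSup_image_neg {X : Type*} (u : X → ℝ) (B : Set X) :
    sSup ((fun x => -u x) '' B) = -sInf (u '' B) := by
  rw [← Real.sSup_neg, ← Set.image_neg_eq_neg, Set.image_image]

theorem sInf_image_neg {X : Type*} (u : X → ℝ) (B : Set X) :
    sInf ((fun x => -u x) '' B) = -sSup (u '' B) := by
  rw [← Real.sInf_neg, ← Set.image_neg_eq_neg, Set.image_image]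

theorem bddAbove_image_of_abs_le {X : Type*} {u : X → ℝ} {C : ℝ} (hu : ∀ x, |u x| ≤ C) (B : Set X) :
    BddAbove (u '' B) :=
  ⟨C, by rintro _ ⟨x, -, rfl⟩; exact (abs_le.1 (hu x)).2⟩

theorem bddBelow_image_of_abs_le {X : Type*} {u : X → ℝ} {C : ℝ} (hu : ∀ x, |u x| ≤ C) (B : Set X) :
    BddBelow (u '' B) :=
  ⟨-C, by rintro _ ⟨x, -, rfl⟩; exact (abs_le.1 (hu x)).1⟩

section Comparison

variable {X : Type*} [MetricSpace X] {p q ε C M : ℝ} {S : Set X} {u v : X → ℝ}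

theorem SubAverageOn.neg (h : SubAverageOn p q ε S u) :
    SuperAverageOn q p ε S (fun x => -u x) := by
  intro x hx
  rw [sSup_image_neg, sInf_image_neg]
  linarith [h x hx]

theorem SuperAverageOn.neg (h : SuperAverageOn p q ε S u) :
    SubAverageOn q p ε S (fun x => -u x) := by
  intro x hx
  rw [sSup_image_neg, sInf_image_neg]
  linarith [h x hx]

/-- Where `u - v` is nearly maximal, so is the difference of the suprema over the ball. -/
theorem lt_mul_sSup_sub_sSup (hε : 0 < ε) (hq : 0 < q) (hsum : p + q = 1)
    (hu : ∀ x, |u x| ≤ C) (hw : ∀ x, u x - v x ≤ M)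
    (hsub : SubAverageOn p q ε S u) (hsup : SuperAverageOn p q ε S v) {δ : ℝ} {x : X}
    (hxS : x ∈ S) (hx : M - δ < u x - v x) :
    p * M - δ < p * (sSup (u '' ball x ε) - sSup (v '' ball x ε)) := by
  have hI : sInf (u '' ball x ε) - M ≤ sInf (v '' ball x ε) := by
    refine le_csInf ⟨_, x, mem_ball_self hε, rfl⟩ ?_
    rintro _ ⟨y, hy, rfl⟩
    linarith [csInf_le (bddBelow_image_of_abs_le hu (ball x ε)) ⟨y, hy, rfl⟩, hw y]
  have h1 := hsub x hxS
  have h2 := hsup x hxS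
  have h3 := mul_le_mul_of_nonneg_left hI hq.le
  obtain rfl : q = 1 - p := by linarith
  linarith

/-- When the weight of the supremum is at most that of the infimum, ascending along `u` from a point
where `u - v` is nearly maximal cannot lose slope, which bounds `u` there. -/
theorem exists_add_nsmul_le (hε : 0 < ε) (hp : 0 < p) (hpq : p ≤ q) (hsum : p + q = 1)
    (hu : ∀ x, |u x| ≤ C) (hv : ∀ x, |v x| ≤ C) (hM : 0 < M) (hw : ∀ x, u x - v x ≤ M)
    (hS : ∀ x ∉ S, u x ≤ v x) (hsub : SubAverageOn p q ε S u) (hsup : SuperAverageOn p q ε S v)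
    {a : ℝ} (ha : 0 < a) (n : ℕ) :
    ∃ δ > 0, ∀ x, M - δ < u x - v x → u x + a < sSup (u '' ball x ε) → u x + n * a ≤ C := by
  induction n with
  | zero => exact ⟨1, one_pos, fun x _ _ => by simpa using (abs_le.1 (hu x)).2⟩
  | succ n ih =>
    obtain ⟨δ, hδ, ih⟩ := ih
    have hd : 0 < min M δ := lt_min hM hδ
    refine ⟨min (p * (min M δ / 2)) M, by positivity, fun x hx hxa => ?_⟩
    have hx1 : M - p * (min M δ / 2) < u x - v x := by
      linarith [min_le_left (p * (min M δ / 2)) M]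
    have hxS : x ∈ S := by
      by_contra h
      linarith [hS x h, min_le_right (p * (min M δ / 2)) M]
    have hdiff : M - min M δ / 2 < sSup (u '' ball x ε) - sSup (v '' ball x ε) := by
      have := lt_mul_sSup_sub_sSup hε (hp.trans_le hpq) hsum hu hw hsub hsup hxS hx1
      refine lt_of_mul_lt_mul_left ?_ hp.le
      linarith
    obtain ⟨_, ⟨y, hy, rfl⟩, hyu⟩ := exists_lt_of_lt_csSup
      (s := u '' ball x ε) (b := max (u x + a) (sSup (u '' ball x ε) - min M δ / 2))
      ⟨_, x, mem_ball_self hε, rfl⟩ (max_lt hxa (by linarith))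
    obtain ⟨hy1, hy2⟩ := max_lt_iff.1 hyu
    have hvy := le_csSup (bddAbove_image_of_abs_le hv (ball x ε)) ⟨y, hy, rfl⟩
    have hyw : M - min M δ < u y - v y := by linarith
    have hyS : y ∈ S := by
      by_contra h
      linarith [hS y h, min_le_left M δ]
    have hIy := csInf_le (bddBelow_image_of_abs_le hu (ball y ε))
      ⟨x, mem_ball_comm.1 hy, rfl⟩
    have hya : u y + a < sSup (u '' ball y ε) := by
      have h1 := hsub y hyS
      obtain rfl : q = 1 - p := by linarith
      have h3 : (1 - p) * a < (1 - p) * (u y - sInf (u '' ball y ε)) :=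
        mul_lt_mul_of_pos_left (by linarith) (by linarith)
      have h4 : p * a ≤ (1 - p) * a := mul_le_mul_of_nonneg_right hpq ha.le
      have h5 : p * (u y + a) < p * sSup (u '' ball y ε) := by linarith
      exact lt_of_mul_lt_mul_left h5 hp.le
    have := ih y (by linarith [min_le_right M δ]) hya
    push_cast
    linarith

theorem exists_sub_le_of_mem_ball_of_le (hε : 0 < ε) (hp : 0 < p) (hpq : p ≤ q) (hsum : p + q = 1)
    (hu : ∀ x, |u x| ≤ C) (hv : ∀ x, |v x| ≤ C) (hM : 0 < M) (hw : ∀ x, u x - v x ≤ M)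
    (hS : ∀ x ∉ S, u x ≤ v x) (hsub : SubAverageOn p q ε S u) (hsup : SuperAverageOn p q ε S v)
    {δ : ℝ} (hδ : 0 < δ) :
    ∃ δ' > 0, ∀ x, ∀ y ∈ ball x ε, u y - v y ≤ M - δ → u x - v x ≤ M - δ' := by
  have ha : 0 < δ / 4 := by positivity
  obtain ⟨n, hn⟩ := exists_nat_gt (2 * C / (δ / 4))
  rw [div_lt_iff₀ ha] at hn
  obtain ⟨δ₁, hδ₁, h₁⟩ := exists_add_nsmul_le hε hp hpq hsum hu hv hM hw hS hsub hsup ha n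
  refine ⟨min (min δ₁ M) (p * (δ / 2)), by positivity, fun x y hy hyw => ?_⟩
  by_contra! hx
  have m1 := min_le_left (min δ₁ M) (p * (δ / 2))
  have m2 := min_le_right (min δ₁ M) (p * (δ / 2))
  have hxS : x ∈ S := by
    by_contra h
    linarith [hS x h, min_le_right δ₁ M]
  have hSu : sSup (u '' ball x ε) ≤ u x + δ / 4 := by
    by_contra! h
    linarith [h₁ x (by linarith [min_le_left δ₁ M]) h, (abs_le.1 (hu x)).1]
  have hIu : u x - δ / 4 ≤ sInf (u '' ball x ε) := by
    have h1 := hsub x hxS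
    have h2 := mul_le_mul_of_nonneg_left hSu hp.le
    obtain rfl : q = 1 - p := by linarith
    have h4 : p * (δ / 4) ≤ (1 - p) * (δ / 4) := mul_le_mul_of_nonneg_right hpq ha.le
    have h5 : (1 - p) * (u x - δ / 4) ≤ (1 - p) * sInf (u '' ball x ε) := by linarith
    exact le_of_mul_le_mul_left h5 (by linarith)
  have hdiff : M - δ / 2 < sSup (u '' ball x ε) - sSup (v '' ball x ε) := by
    have := lt_mul_sSup_sub_sSup (δ := p * (δ / 2)) hε (hp.trans_le hpq) hsum hu hw hsub hsup
      hxS (by linarith)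
    refine lt_of_mul_lt_mul_left ?_ hp.le
    linarith
  have hvy := le_csSup (bddAbove_image_of_abs_le hv (ball x ε)) ⟨y, hy, rfl⟩
  have huy := csInf_le (bddBelow_image_of_abs_le hu (ball x ε)) ⟨y, hy, rfl⟩
  linarith

/-- If `u - v` is bounded away from its upper bound `M` somewhere in a ball, then it is so at the
centre, uniformly in the ball. -/
theorem exists_sub_le_of_mem_ball (hε : 0 < ε) (hp : 0 < p) (hq : 0 < q) (hsum : p + q = 1)
    (hu : ∀ x, |u x| ≤ C) (hv : ∀ x, |v x| ≤ C) (hM : 0 < M) (hw : ∀ x, u x - v x ≤ M)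
    (hS : ∀ x ∉ S, u x ≤ v x) (hsub : SubAverageOn p q ε S u) (hsup : SuperAverageOn p q ε S v)
    {δ : ℝ} (hδ : 0 < δ) :
    ∃ δ' > 0, ∀ x, ∀ y ∈ ball x ε, u y - v y ≤ M - δ → u x - v x ≤ M - δ' := by
  rcases le_total p q with h | h
  · exact exists_sub_le_of_mem_ball_of_le hε hp h hsum hu hv hM hw hS hsub hsup hδ
  · have hneg : ∀ x, -v x - -u x = u x - v x := fun x => by ring
    simpa only [hneg] using exists_sub_le_of_mem_ball_of_le (u := fun x => -v x)
      (v := fun x => -u x) (C := C) (M := M) (S := S) hε hq h (by linarith)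
      (by simpa using hv) (by simpa using hu) hM (by simpa only [hneg] using hw)
      (by simpa using hS) hsup.neg hsub.neg hδ

/-- Comparison principle for bounded functions. -/
theorem SubAverageOn.le_of_abs_le [CompactSpace X] [PreconnectedSpace X]
    (hε : 0 < ε) (hp : 0 < p) (hq : 0 < q) (hsum : p + q = 1)
    (hSne : Sᶜ.Nonempty) (hu : ∀ x, |u x| ≤ C) (hv : ∀ x, |v x| ≤ C)
    (hS : ∀ x ∉ S, u x ≤ v x) (hsub : SubAverageOn p q ε S u) (hsup : SuperAverageOn p q ε S v)
    (x : X) : u x ≤ v x := by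
  set w : X → ℝ := fun x => u x - v x with hwdef
  have hbdd : BddAbove (range w) := by
    refine ⟨2 * C, ?_⟩
    rintro _ ⟨z, rfl⟩
    simp only [hwdef]
    linarith [(abs_le.1 (hu z)).2, (abs_le.1 (hv z)).1]
  have hw : ∀ z, w z ≤ ⨆ z, w z := le_ciSup hbdd
  by_contra! hx
  have hM : 0 < ⨆ z, w z := lt_of_lt_of_le (sub_pos.2 hx) (hw x)
  have key := fun δ (hδ : 0 < δ) =>
    exists_sub_le_of_mem_ball hε hp hq hsum hu hv hM hw hS hsub hsup hδ
  set M := ⨆ z, w z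
  set G : Set X := {z | ∃ δ > 0, ∀ᶠ y in nhds z, w y ≤ M - δ} with hG
  have hnear : ∀ δ > 0, ∀ y, w y ≤ M - δ → ball y ε ⊆ G := by
    intro δ hδ y hy z hz
    obtain ⟨δ', hδ', h⟩ := key δ hδ
    exact ⟨δ', hδ', Filter.eventually_of_mem (isOpen_ball.mem_nhds hz)
      fun t ht => h t y (mem_ball_comm.1 ht) hy⟩
  have hopen : IsOpen G := by
    rw [isOpen_iff_eventually]
    rintro z ⟨δ, hδ, h⟩
    exact (eventually_eventually_nhds.2 h).mono fun t ht => ⟨δ, hδ, ht⟩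
  have hclosed : IsClosed G := by
    refine isClosed_of_closure_subset fun z hz => ?_
    obtain ⟨y, ⟨δ, hδ, hy⟩, hzy⟩ := Metric.mem_closure_iff.1 hz ε hε
    exact hnear δ hδ y hy.self_of_nhds hzy
  have hne : G.Nonempty := by
    obtain ⟨y, hy⟩ := hSne
    exact ⟨y, hnear M hM y (by simpa [hwdef] using hS y hy) (mem_ball_self hε)⟩
  have huniv : G = univ := IsClopen.eq_univ ⟨hclosed, hopen⟩ hne
  obtain ⟨δ, hδ, h⟩ : ∃ δ > 0, ∀ y ∈ (univ : Set X), w y ≤ M - δ := by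
    refine isCompact_univ.induction_on (p := fun s => ∃ δ > 0, ∀ y ∈ s, w y ≤ M - δ)
      ⟨1, one_pos, by simp⟩ ?_ ?_ ?_
    · rintro s t hst ⟨δ, hδ, h⟩
      exact ⟨δ, hδ, fun y hy => h y (hst hy)⟩
    · rintro s t ⟨δ, hδ, h⟩ ⟨δ', hδ', h'⟩
      refine ⟨min δ δ', lt_min hδ hδ', ?_⟩
      rintro y (hy | hy)
      · linarith [h y hy, min_le_left δ δ']
      · linarith [h' y hy, min_le_right δ δ']
    · intro z _
      obtain ⟨δ, hδ, h⟩ : z ∈ G := huniv ▸ mem_univ z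
      exact ⟨_, mem_nhdsWithin_of_mem_nhds h, δ, hδ, fun y hy => hy⟩
  have : Nonempty X := ⟨x⟩
  have hle : M ≤ M - δ := ciSup_le fun z => h z (mem_univ z)
  linarith

theorem SuperAverageOn.min_const (hε : 0 < ε) (hp : 0 ≤ p) (hq : 0 ≤ q) (hsum : p + q = 1)
    {c : ℝ} (hc : ∀ x, c ≤ v x) (hv : ∀ x ∈ S, BddAbove (v '' ball x ε))
    (h : SuperAverageOn p q ε S v) (D : ℝ) :
    SuperAverageOn p q ε S (fun x => min (v x) D) := by
  intro x hx
  have hxb : x ∈ ball x ε := mem_ball_self hε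
  have hbelow : BddBelow ((fun x => min (v x) D) '' ball x ε) := by
    refine ⟨min c D, ?_⟩
    rintro _ ⟨y, -, rfl⟩
    exact min_le_min_right D (hc y)
  have hS1 : sSup ((fun x => min (v x) D) '' ball x ε) ≤ min (sSup (v '' ball x ε)) D := by
    refine csSup_le ⟨_, x, hxb, rfl⟩ ?_
    rintro _ ⟨y, hy, rfl⟩
    exact min_le_min_right D (le_csSup (hv x hx) ⟨y, hy, rfl⟩)
  have hI1 : sInf ((fun x => min (v x) D) '' ball x ε) ≤ sInf (v '' ball x ε) := by
    refine le_csInf ⟨_, x, hxb, rfl⟩ ?_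
    rintro _ ⟨y, hy, rfl⟩
    exact (csInf_le hbelow ⟨y, hy, rfl⟩).trans (min_le_left _ _)
  have hI2 : sInf ((fun x => min (v x) D) '' ball x ε) ≤ D :=
    (csInf_le hbelow ⟨x, hxb, rfl⟩).trans (min_le_right _ _)
  obtain ⟨hS2, hS3⟩ := le_min_iff.1 hS1
  refine le_min ?_ ?_
  · exact (add_le_add (mul_le_mul_of_nonneg_left hS2 hp)
      (mul_le_mul_of_nonneg_left hI1 hq)).trans (h x hx)
  · calc _ ≤ p * D + q * D := add_le_add (mul_le_mul_of_nonneg_left hS3 hp)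
          (mul_le_mul_of_nonneg_left hI2 hq)
      _ = D := by rw [← add_mul, hsum, one_mul]

/-- Comparison principle in which the upper function is only bounded below. -/
theorem SubAverageOn.le_of_bddBelow [CompactSpace X] [PreconnectedSpace X]
    (hε : 0 < ε) (hp : 0 < p) (hq : 0 < q) (hsum : p + q = 1)
    (hSne : Sᶜ.Nonempty) (hu : ∀ x, |u x| ≤ C) {c : ℝ} (hc : ∀ x, c ≤ v x)
    (hv : ∀ x ∈ S, BddAbove (v '' ball x ε)) (hS : ∀ x ∉ S, u x ≤ v x)
    (hsub : SubAverageOn p q ε S u) (hsup : SuperAverageOn p q ε S v) (x : X) : u x ≤ v x := by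
  have hCc : C ≤ max C (-c) := le_max_left _ _
  have hcc : -c ≤ max C (-c) := le_max_right _ _
  have hC0 : 0 ≤ C := (abs_nonneg _).trans (hu x)
  refine (SubAverageOn.le_of_abs_le (v := fun x => min (v x) C) (C := max C (-c)) hε hp hq hsum
    hSne (fun z => (hu z).trans hCc) (fun z => abs_le.2 ⟨?_, ?_⟩)
    (fun z hz => le_min (hS z hz) (abs_le.1 (hu z)).2) hsub
    (hsup.min_const hε hp.le hq.le hsum hc hv C) x).trans (min_le_left _ _)
  · exact le_min (by linarith [hc z]) (by linarith)
  · exact (min_le_right _ _).trans hCc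

end Comparison

theorem IsLengthSpace.preconnectedSpace {X : Type*} [MetricSpace X] (hX : IsLengthSpace X) :
    PreconnectedSpace X := by
  rcases isEmpty_or_nonempty X with h | h
  · infer_instance
  · have : PathConnectedSpace X := ⟨h, fun x y => by
      by_contra hne
      have : IsEmpty (Path x y) := not_nonempty_iff.1 hne
      exact edist_ne_top x y (by rw [hX x y, iInf_of_empty])⟩
    infer_instance

theorem InfinityHarmonicOn.subAverageOn {X : Type*} [MetricSpace X] {θ ε : ℝ} {S : Set X}
    {u : X → ℝ} (h : InfinityHarmonicOn θ ε S u) :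
    SubAverageOn ((1 + θ) / 2) ((1 - θ) / 2) ε S u :=
  fun x hx => (h x hx).2.2.le

theorem InfinityHarmonicOn.superAverageOn {X : Type*} [MetricSpace X] {θ ε : ℝ} {S : Set X}
    {u : X → ℝ} (h : InfinityHarmonicOn θ ε S u) :
    SuperAverageOn ((1 + θ) / 2) ((1 - θ) / 2) ε S u :=
  fun x hx => (h x hx).2.2.ge


/-- The unique bounded `(θ,ε)`-infinity harmonic extension `u^ε` of `F` is the
smallest `(θ,ε)`-infinity harmonic function bounded from below lying above `F` on `Y`, and the
largest one bounded from above lying below `F` on `Y`. -/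
theorem infinity_harmonic_extension_extremal
    {X : Type*} [MetricSpace X] [CompactSpace X] (hX : IsLengthSpace X)
    (Y : Set X) (hYne : Y.Nonempty) (hYcl : IsClosed Y)
    (F : Y → ℝ) (K : NNReal) (hF : LipschitzWith K F)
    (ε θ : ℝ) (hε : 0 < ε) (hθ : θ ∈ Set.Ioo (-1 : ℝ) 1)
    (uε : X → ℝ) (hub : ∃ C : ℝ, ∀ x, |uε x| ≤ C) (hue : ∀ y : Y, uε y = F y)
    (huh : InfinityHarmonicOn θ ε Yᶜ uε) :
    (∀ v : X → ℝ, (∃ C : ℝ, ∀ x, C ≤ v x) → InfinityHarmonicOn θ ε Yᶜ v →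
      (∀ y : Y, F y ≤ v y) → ∀ x, uε x ≤ v x) ∧
    (∀ v : X → ℝ, (∃ C : ℝ, ∀ x, v x ≤ C) → InfinityHarmonicOn θ ε Yᶜ v →
      (∀ y : Y, v y ≤ F y) → ∀ x, v x ≤ uε x) := by
  have := hX.preconnectedSpace
  obtain ⟨C, hC⟩ := hub
  have hp : 0 < (1 + θ) / 2 := by linarith [hθ.1]
  have hq : 0 < (1 - θ) / 2 := by linarith [hθ.2]
  have hYne' : (Yᶜᶜ).Nonempty := by rwa [compl_compl]
  constructor
  · rintro v ⟨c, hc⟩ hv hFv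
    refine huh.subAverageOn.le_of_bddBelow hε hp hq (by ring) hYne' hC hc
      (fun x hx => (hv x hx).1) (fun x hx => ?_) hv.superAverageOn
    have hxY : x ∈ Y := not_not.1 hx
    exact (hue ⟨x, hxY⟩).trans_le (hFv ⟨x, hxY⟩)
  · rintro v ⟨c, hc⟩ hv hFv x
    refine neg_le_neg_iff.1 (huh.superAverageOn.neg.le_of_bddBelow (v := fun x => -v x) hε hq hp
      (by ring) hYne' (fun x => (abs_neg _).trans_le (hC x)) (fun x => neg_le_neg (hc x))
      (fun x hx => ?_) (fun x hx => ?_) hv.subAverageOn.neg x)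
    · have hb := (hv x hx).2.1.neg
      rwa [← Set.image_neg_eq_neg, Set.image_image] at hb
    · have hxY : x ∈ Y := not_not.1 hx
      exact neg_le_neg ((hFv ⟨x, hxY⟩).trans_eq (hue ⟨x, hxY⟩).symm)
end

section
/- Let β > 0, let X be a compact length space, Y ⊆ X a nonempty closed subset, and F : Y → ℝ Lipschitz with Lipschitz constant Lip_Y F. There exists ε₀ > 0 such that for every ε ∈ (0,ε₀) and every θ ∈ (0,1) with (1+θ)/(1−θ) ≤ 1 + 2βε, the unique bounded (θ,ε)-infinity harmonic extension u of F satisfies: for all x ∈ X and y ∈ Y with η := d^ε(x,y) ∈ [ε,1), u(x) ≤ F(y) + √η · (Lip_Y F + e^{4β√η} · sup_{y'∈Y}|F(y')|). -/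
open Set Metric Filter

/-- In a length space, a point `x` with `dist x y < a + b` can be moved by less than `a` so as to
come closer than `b` to `y`. -/
theorem IsLengthSpace.exists_dist_lt_dist_lt {X : Type*} [MetricSpace X] (hX : IsLengthSpace X)
    {x y : X} {a b : ℝ} (ha : 0 < a) (hb : 0 < b) (h : dist x y < a + b) :
    ∃ z, dist x z < a ∧ dist z y < b := by
  by_cases hxb : dist x y < b
  · exact ⟨x, by simpa using ha, hxb⟩
  by_cases hxa : dist x y < a
  · exact ⟨y, hxa, by simpa using hb⟩
  rw [not_lt] at hxa hxb
  have hlt : (⨅ γ : Path x y, eVariationOn (fun t => γ t) Set.univ) < ENNReal.ofReal (a + b) := by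
    rw [← hX x y, edist_dist]
    exact (ENNReal.ofReal_lt_ofReal_iff (by linarith)).2 h
  obtain ⟨γ, hγ⟩ := iInf_lt_iff.1 hlt
  obtain ⟨L, hL, hLab⟩ : ∃ L : ℝ, (∀ t, dist x (γ t) + dist (γ t) y ≤ L) ∧ L < a + b := by
    refine ⟨(eVariationOn (fun t => γ t) Set.univ).toReal, fun t => ?_, ?_⟩
    · rw [← ENNReal.ofReal_le_iff_le_toReal hγ.ne_top, ENNReal.ofReal_add dist_nonneg dist_nonneg,
        ← edist_dist, ← edist_dist]
      have h₁ := eVariationOn.edist_le (fun t => γ t) (s := Set.Iic t) (x := 0) (y := t)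
        t.2.1 self_mem_Iic
      have h₂ := eVariationOn.edist_le (fun t => γ t) (s := Set.Ici t) (x := t) (y := 1)
        self_mem_Ici t.2.2
      have h₃ := eVariationOn.add_le_union (fun t => γ t) (s := Set.Iic t) (t := Set.Ici t)
        fun _ hx _ hy => le_trans hx hy
      simp only [Path.source, Path.target, Set.Iic_union_Ici] at h₁ h₂ h₃
      exact (add_le_add h₁ h₂).trans h₃
    · rwa [← ENNReal.lt_ofReal_iff_toReal_lt hγ.ne_top]
  have hL₀ : dist x y ≤ L := by simpa using hL 0
  obtain ⟨t, ht⟩ : (L - b + a) / 2 ∈ Set.range fun t => dist x (γ t) :=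
    mem_range_of_exists_le_of_exists_ge (by fun_prop)
      ⟨0, by simp only [Path.source, dist_self]; linarith⟩
      ⟨1, by simp only [Path.target]; linarith⟩
  have := hL t
  simp only at ht
  exact ⟨γ t, by linarith, by linarith⟩

/-- The geometric sequence with ratio `(1 - θ) / (1 + θ)` is harmonic for the walk on `ℕ` that moves
up with probability `(1 + θ) / 2` and down with probability `(1 - θ) / 2`. -/
theorem biased_walk_geometric_harmonic {θ : ℝ} (hθ : 1 + θ ≠ 0) (n : ℕ) :
    (1 + θ) / 2 * ((1 - θ) / (1 + θ)) ^ (n + 2) + (1 - θ) / 2 * ((1 - θ) / (1 + θ)) ^ n =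
      ((1 - θ) / (1 + θ)) ^ (n + 1) := by
  have hr : (1 + θ) * ((1 - θ) / (1 + θ)) = 1 - θ := by field_simp
  generalize (1 - θ) / (1 + θ) = r at hr ⊢
  linear_combination (r ^ (n + 1) - r ^ n) / 2 * hr

/-- An upper bound for a bounded infinity harmonic function by a function of the number of steps of
size `ε` needed to reach `y`, up to an error `S`, improves by a definite factor. -/
theorem InfinityHarmonicOn.le_add_mul_of_le_add {X : Type*} [MetricSpace X] (hX : IsLengthSpace X)
    {Y : Set X} {θ ε : ℝ} (hε : 0 < ε) (hθ : θ ∈ Set.Icc (0 : ℝ) 1) {u : X → ℝ}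
    (hu : InfinityHarmonicOn θ ε Yᶜ u) {y : X} {φ : ℕ → ℝ} (hy : u y ≤ φ 0)
    (hφ : ∀ n, (1 + θ) / 2 * φ (n + 2) + (1 - θ) / 2 * φ n ≤ φ (n + 1))
    (hY : ∀ z ∈ Y, ∀ n : ℕ, dist z y < n * ε → u z ≤ φ n) {S : ℝ} (hS : 0 ≤ S)
    (hle : ∀ z, ∀ n : ℕ, dist z y < n * ε → u z ≤ φ n + S) (n : ℕ) :
    ∀ z, dist z y < n * ε → u z ≤ φ n + S * (1 - ((1 - θ) / 2) ^ n) := by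
  have hq₀ : 0 ≤ (1 - θ) / 2 := by linarith [hθ.2]
  have hq₁ : (1 - θ) / 2 ≤ 1 := by linarith [hθ.1]
  induction n with
  | zero =>
    intro z hz
    simp only [Nat.cast_zero, zero_mul] at hz
    exact absurd hz dist_nonneg.not_gt
  | succ n ih =>
    intro z hz
    have hpow : 0 ≤ S * (1 - ((1 - θ) / 2) ^ (n + 1)) :=
      mul_nonneg hS (sub_nonneg.2 (pow_le_one₀ hq₀ hq₁))
    by_cases hzY : z ∈ Y
    · linarith [hY z hzY _ hz]
    obtain ⟨-, hbelow, heq⟩ := hu z hzY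
    have hsup : sSup (u '' ball z ε) ≤ φ (n + 2) + S := by
      refine csSup_le ((nonempty_ball.2 hε).image u) ?_
      rintro _ ⟨w, hw, rfl⟩
      refine hle w (n + 2) ?_
      push_cast at hz ⊢
      linarith [dist_triangle w z y, mem_ball.1 hw]
    have hinf : sInf (u '' ball z ε) ≤ φ n + S * (1 - ((1 - θ) / 2) ^ n) := by
      rcases Nat.eq_zero_or_pos n with rfl | hn
      · refine (csInf_le hbelow ⟨y, ?_, rfl⟩).trans (by simpa using hy)
        rw [mem_ball, dist_comm]
        simpa using hz
      · obtain ⟨w, hzw, hwy⟩ := hX.exists_dist_lt_dist_lt (x := z) (y := y) hε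
          (b := n * ε) (by positivity) (by push_cast at hz; linarith)
        exact (csInf_le hbelow ⟨w, by rwa [mem_ball, dist_comm], rfl⟩).trans (ih w hwy)
    have h₁ := mul_le_mul_of_nonneg_left hsup (by linarith [hθ.1] : 0 ≤ (1 + θ) / 2)
    have h₂ := mul_le_mul_of_nonneg_left hinf hq₀
    rw [heq, pow_succ']
    linarith [hφ n]

/-- Comparison of a bounded infinity harmonic function with a monotone supersolution depending only
on the number of steps of size `ε` needed to reach `y`. -/
theorem InfinityHarmonicOn.le_of_forall_mem_le {X : Type*} [MetricSpace X] [BoundedSpace X]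
    (hX : IsLengthSpace X) {Y : Set X} {θ ε : ℝ} (hε : 0 < ε) (hθ : θ ∈ Set.Ico (0 : ℝ) 1)
    {u : X → ℝ} (hbdd : BddAbove (Set.range u))
    (hu : InfinityHarmonicOn θ ε Yᶜ u) {y : X} {φ : ℕ → ℝ} (hmono : Monotone φ) (hy : u y ≤ φ 0)
    (hφ : ∀ n, (1 + θ) / 2 * φ (n + 2) + (1 - θ) / 2 * φ n ≤ φ (n + 1))
    (hY : ∀ z ∈ Y, ∀ n : ℕ, dist z y < n * ε → u z ≤ φ n) {z : X} {n : ℕ}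
    (hz : dist z y < n * ε) : u z ≤ φ n := by
  obtain ⟨N, hN⟩ : ∃ N : ℕ, ∀ z, dist z y < N * ε := by
    obtain ⟨N, hN⟩ := exists_nat_gt (Metric.diam (Set.univ : Set X) / ε)
    refine ⟨N, fun z => ?_⟩
    rw [div_lt_iff₀ hε] at hN
    exact (dist_le_diam_of_mem BoundedSpace.bounded_univ trivial trivial).trans_lt hN
  obtain ⟨C, hC⟩ := hbdd
  set q := ((1 - θ) / 2) ^ N
  have hq₀ : 0 < q := pow_pos (by linarith [hθ.2]) _
  have hq₁ : q ≤ 1 := pow_le_one₀ (by linarith [hθ.2]) (by linarith [hθ.1])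
  have hS : 0 ≤ |C - φ 0| := abs_nonneg _
  have key : ∀ k : ℕ, ∀ z, ∀ n : ℕ, dist z y < n * ε → u z ≤ φ n + |C - φ 0| * (1 - q) ^ k := by
    intro k
    induction k with
    | zero =>
      intro z n _
      linarith [hC ⟨z, rfl⟩, hmono (Nat.zero_le n), le_abs_self (C - φ 0)]
    | succ k ih =>
      intro z n hz
      have hSk : 0 ≤ |C - φ 0| * (1 - q) ^ k := mul_nonneg hS (pow_nonneg (by linarith) _)
      have step := fun m => hu.le_add_mul_of_le_add hX hε ⟨hθ.1, hθ.2.le⟩ hy hφ hY hSk ih m z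
      rw [pow_succ, ← mul_assoc]
      rcases le_total n N with hnN | hNn
      · refine (step n hz).trans ?_
        gcongr
        exact pow_le_pow_of_le_one (by linarith [hθ.2]) (by linarith [hθ.1]) hnN
      · exact (step N (hN z)).trans (by gcongr; exact hmono hNn)
  have hlim : Tendsto (fun k : ℕ => φ n + |C - φ 0| * (1 - q) ^ k) atTop (nhds (φ n)) := by
    simpa using ((tendsto_pow_atTop_nhds_zero_of_lt_one (by linarith : 0 ≤ 1 - q)
      (by linarith)).const_mul |C - φ 0|).const_add (φ n)
  exact ge_of_tendsto' hlim fun k => key k z n hz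

/-- A bounded infinity harmonic function is bounded by an explicit discrete exponential cone
centered at a boundary point. -/
theorem InfinityHarmonicOn.le_discrete_cone {X : Type*} [MetricSpace X] [BoundedSpace X]
    (hX : IsLengthSpace X) {Y : Set X} {θ ε : ℝ} (hε : 0 < ε) (hθ : θ ∈ Set.Ioo (0 : ℝ) 1)
    {u : X → ℝ} (hbdd : BddAbove (Set.range u)) (hu : InfinityHarmonicOn θ ε Yᶜ u) {y : X}
    {K M : ℝ} (hK : 0 ≤ K) (hM : 0 ≤ M) (hlip : ∀ z ∈ Y, u z ≤ u y + K * dist z y)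
    (hosc : ∀ z ∈ Y, u z ≤ u y + M) {z : X} {n : ℕ} (hz : dist z y < n * ε) :
    u z ≤ u y + K * (n * ε) + M * (n * ((1 + θ) / (1 - θ) - 1)) := by
  obtain ⟨hθ₀, hθ₁⟩ := hθ
  have h₁ : 0 < 1 + θ := by linarith
  have h₂ : 0 < 1 - θ := by linarith
  set κ := (1 + θ) / (1 - θ) - 1 with hκ
  set r := (1 - θ) / (1 + θ) with hr
  have hκ₀ : 0 < κ := by
    rw [hκ, sub_pos, lt_div_iff₀ h₂]
    linarith
  have hr₀ : 0 < r := div_pos h₂ h₁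
  have hrκ : r * (1 + κ) = 1 := by
    rw [hκ, hr]
    field_simp
    ring
  have hr₁ : r ≤ 1 := by nlinarith
  have hA : 0 ≤ K * ε / κ + M := by positivity
  have hcone : ∀ m : ℕ, (K * ε / κ + M) * (m * κ) = K * (m * ε) + M * (m * κ) := fun m => by
    field_simp
  have hup : u z ≤ u y + (K * ε / κ + M) * (1 - r ^ n) := by
    refine hu.le_of_forall_mem_le hX hε ⟨hθ₀.le, hθ₁⟩ hbdd
      (φ := fun m => u y + (K * ε / κ + M) * (1 - r ^ m)) ?_ (by simp) ?_ ?_ hz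
    · intro i j hij
      have := pow_le_pow_of_le_one hr₀.le hr₁ hij
      dsimp only
      gcongr
    · intro m
      have := biased_walk_geometric_harmonic h₁.ne' m
      rw [← hr] at this
      rw [← this]
      apply le_of_eq
      ring
    · intro w hw m hwm
      have hpow : r ^ m * (1 + m * κ) ≤ 1 :=
        calc r ^ m * (1 + m * κ) ≤ r ^ m * (1 + κ) ^ m := by
              gcongr
              exact one_add_mul_le_pow (by linarith) m
          _ = 1 := by rw [← mul_pow, hrκ, one_pow]
      have hmκ : 0 ≤ m * κ := by positivity
      have hd : u w - u y ≤ K * (m * ε) := by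
        have := mul_le_mul_of_nonneg_left hwm.le hK
        linarith [hlip w hw]
      have hM' : (u w - u y) * (m * κ) ≤ M * (m * κ) := by
        gcongr
        linarith [hosc w hw]
      have hA' : (K * ε / κ + M) * (r ^ m * (1 + m * κ)) ≤ K * ε / κ + M :=
        mul_le_of_le_one_right hA hpow
      have : (u w - u y) * (1 + m * κ) ≤ (K * ε / κ + M) * (1 - r ^ m) * (1 + m * κ) := by
        linarith [hcone m]
      linarith [le_of_mul_le_mul_right this (by positivity)]
  have hbern : 1 - r ^ n ≤ n * κ := by
    have h₃ := one_add_mul_le_pow (a := r - 1) (by linarith) n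
    have h₄ : (1 - r : ℝ) ≤ κ := by nlinarith
    have h₅ := mul_le_mul_of_nonneg_left h₄ (Nat.cast_nonneg (α := ℝ) n)
    rw [add_sub_cancel] at h₃
    linarith
  linarith [mul_le_mul_of_nonneg_left hbern hA, hcone n]

/-- For `β > 0` there is `ε₀ > 0` such that for every `ε ∈ (0,ε₀)` and every
`θ ∈ (0,1)` with `(1+θ)/(1−θ) ≤ 1 + 2βε`, the unique bounded `(θ,ε)`-infinity harmonic
extension `u` of `F` satisfies, for all `x ∈ X`, `y ∈ Y` with `η := d^ε(x,y) ∈ [ε,1)`,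
`u(x) ≤ F(y) + √η·(Lip_Y F + e^{4β√η}·sup_{y'∈Y}|F(y')|)`. -/
theorem infinity_harmonic_sqrt_bound
    {X : Type*} [MetricSpace X] [CompactSpace X] (hX : IsLengthSpace X)
    (Y : Set X) (hYne : Y.Nonempty) (hYcl : IsClosed Y)
    (F : Y → ℝ) (K : NNReal) (hF : LipschitzWith K F)
    (β : ℝ) (hβ : 0 < β) :
    ∃ ε₀ : ℝ, 0 < ε₀ ∧ ∀ ε : ℝ, 0 < ε → ε < ε₀ →
      ∀ θ : ℝ, θ ∈ Set.Ioo (0 : ℝ) 1 → (1 + θ) / (1 - θ) ≤ 1 + 2 * β * ε →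
      ∀ u : X → ℝ, (∃ C : ℝ, ∀ x, |u x| ≤ C) → (∀ y : Y, u y = F y) →
        InfinityHarmonicOn θ ε Yᶜ u →
      ∀ (x : X) (y : Y), dEps ε x (y : X) ∈ Set.Ico ε 1 →
        u x ≤ F y + Real.sqrt (dEps ε x (y : X)) *
          ((K : ℝ) + Real.exp (4 * β * Real.sqrt (dEps ε x (y : X))) * ⨆ y' : Y, |F y'|) := by
  refine ⟨1, one_pos, fun ε hε _ θ hθ hθβ u ⟨C, hC⟩ huF hu x y hη => ?_⟩
  obtain ⟨n, hn, hxn⟩ : ∃ n : ℕ, dEps ε x (y : X) = n * ε ∧ dist x y < n * ε := by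
    have hxy : x ≠ y := fun h => by
      have := hη.1
      rw [dEps, if_pos h] at this
      linarith
    refine ⟨⌊dist x y / ε⌋₊ + 1, ?_, ?_⟩
    · rw [dEps, if_neg hxy, ← Int.natCast_floor_eq_floor (by positivity)]
      push_cast
      ring
    · rw [← div_lt_iff₀ hε]
      exact_mod_cast Nat.lt_floor_add_one (dist x y / ε)
  have hbddF : BddAbove (Set.range fun y' : Y => |F y'|) := by
    refine ⟨C, ?_⟩
    rintro _ ⟨y', rfl⟩
    simpa [huF] using hC y'
  set M := ⨆ y' : Y, |F y'|
  have hFM : ∀ y' : Y, |F y'| ≤ M := le_ciSup hbddF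
  have hM : 0 ≤ M := (abs_nonneg _).trans (hFM y)
  have hcone := hu.le_discrete_cone hX hε hθ (K := K) (M := 2 * M) (y := y)
    ⟨C, by rintro _ ⟨z, rfl⟩; exact (le_abs_self _).trans (hC z)⟩ K.2 (by positivity)
    (fun z hz => by
      have := (le_abs_self _).trans (hF.dist_le_mul ⟨z, hz⟩ y)
      rw [← huF, ← huF] at this
      exact sub_le_iff_le_add'.1 this)
    (fun z hz => by
      have h₁ := le_of_abs_le (hFM ⟨z, hz⟩)
      have h₂ := neg_le_of_abs_le (hFM y)
      rw [← huF] at h₁ h₂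
      linarith) hxn
  rw [huF, ← hn] at hcone
  set η := dEps ε x (y : X)
  have hη₀ : 0 ≤ η := hε.le.trans hη.1
  have hs₀ := Real.sqrt_nonneg η
  have hs := Real.mul_self_sqrt hη₀
  have hηs : η ≤ √η := Real.le_sqrt_self_iff.2 hη.2.le
  have hexp : 4 * β * √η ≤ Real.exp (4 * β * √η) := by
    linarith [Real.add_one_le_exp (4 * β * √η)]
  have hbias : n * ((1 + θ) / (1 - θ) - 1) ≤ 2 * β * η := by
    have := mul_le_mul_of_nonneg_left hθβ (Nat.cast_nonneg (α := ℝ) n)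
    rw [hn]
    linarith
  calc u x ≤ F y + K * η + 2 * M * (n * ((1 + θ) / (1 - θ) - 1)) := hcone
    _ ≤ F y + K * √η + 2 * M * (2 * β * (√η * √η)) := by rw [hs]; gcongr
    _ = F y + √η * (K + 4 * β * √η * M) := by ring
    _ ≤ F y + √η * (K + Real.exp (4 * β * √η) * M) := by gcongr
end
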